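/- Let A₀, A₁, A₂ be real polynomials in one variable and g₀, g₁ real polynomials in two variables. Define P(x,y) = A₂(x)·(g₀·∂g₁/∂y − g₁·∂g₀/∂y)(x,y) and Q(x,y) = A₀(x)·g₁² + A₁(x)·g₁·g₀ + A₂(x)·g₀² + A₂(x)·(g₁·∂g₀/∂x − g₀·∂g₁/∂x). Let I ⊆ ℝ be an open interval on which A₂(x) ≠ 0, let x₀ ∈ I, and let w : I → ℝ be twice differentiable with A₂ w'' + A₁ w' + A₀ w = 0 on I. Define q(x) = A₂(x)·exp(∫_{x₀}^{x} A₁(s)/A₂(s) ds), f(x,y) = g₁(x,y)·w'(x) − g₀(x,y)·w(x), and V(x,y) = q(x)·f(x,y)². Then for all x ∈ I and y ∈ ℝ, P·∂V/∂x + Q·∂V/∂y = (∂P/∂x + ∂Q/∂y)·V at (x,y); that is, V is an inverse integrating factor of the system ẋ = P, ẏ = Q. -/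

import Mathlib

/-- Evaluation of a polynomial in two variables at `(x, y)`. -/
noncomputable def ev2 (p : MvPolynomial (Fin 2) ℝ) (x y : ℝ) : ℝ :=
  MvPolynomial.eval ![x, y] p

/-- Partial derivative with respect to the first variable. -/
noncomputable def pdX (p : MvPolynomial (Fin 2) ℝ) : MvPolynomial (Fin 2) ℝ :=
  MvPolynomial.pderiv (0 : Fin 2) p

/-- Partial derivative with respect to the second variable. -/
noncomputable def pdY (p : MvPolynomial (Fin 2) ℝ) : MvPolynomial (Fin 2) ℝ :=
  MvPolynomial.pderiv (1 : Fin 2) p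

/-- `P(x,y) = A₂(x) (g₀ ∂g₁/∂y − g₁ ∂g₀/∂y)`. -/
noncomputable def Psys (A₂ : Polynomial ℝ) (g₀ g₁ : MvPolynomial (Fin 2) ℝ) (x y : ℝ) : ℝ :=
  A₂.eval x * (ev2 g₀ x y * ev2 (pdY g₁) x y - ev2 g₁ x y * ev2 (pdY g₀) x y)

/-- `Q(x,y) = A₀ g₁² + A₁ g₁ g₀ + A₂ g₀² + A₂ (g₁ ∂g₀/∂x − g₀ ∂g₁/∂x)`. -/
noncomputable def Qsys (A₀ A₁ A₂ : Polynomial ℝ) (g₀ g₁ : MvPolynomial (Fin 2) ℝ)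
    (x y : ℝ) : ℝ :=
  A₀.eval x * (ev2 g₁ x y) ^ 2 + A₁.eval x * ev2 g₁ x y * ev2 g₀ x y
    + A₂.eval x * (ev2 g₀ x y) ^ 2
    + A₂.eval x * (ev2 g₁ x y * ev2 (pdX g₀) x y - ev2 g₀ x y * ev2 (pdX g₁) x y)

/-- Chain rule for a polynomial in two variables along the first coordinate. -/
theorem hasDerivAt_ev2_fst (p : MvPolynomial (Fin 2) ℝ) (x y : ℝ) :
    HasDerivAt (fun t => ev2 p t y) (ev2 (pdX p) x y) x := by
  simp only [ev2, pdX]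
  induction p using MvPolynomial.induction_on with
  | C a => simpa using hasDerivAt_const x a
  | add p q hp hq => simpa using hp.fun_add hq
  | mul_X p i hp =>
    fin_cases i
    · simpa [mul_comm, add_comm] using hp.fun_mul (hasDerivAt_id x)
    · simpa [mul_comm] using hp.mul_const y

/-- Chain rule for a polynomial in two variables along the second coordinate. -/
theorem hasDerivAt_ev2_snd (p : MvPolynomial (Fin 2) ℝ) (x y : ℝ) :
    HasDerivAt (fun t => ev2 p x t) (ev2 (pdY p) x y) y := by
  simp only [ev2, pdY]
  induction p using MvPolynomial.induction_on with
  | C a => simpa using hasDerivAt_const y a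
  | add p q hp hq => simpa using hp.fun_add hq
  | mul_X p i hp =>
    fin_cases i
    · simpa [mul_comm] using hp.mul_const x
    · simpa [mul_comm, add_comm] using hp.fun_mul (hasDerivAt_id y)

theorem pdX_pdY_comm (p : MvPolynomial (Fin 2) ℝ) : pdX (pdY p) = pdY (pdX p) := by
  simp only [pdX, pdY]
  induction p using MvPolynomial.induction_on with
  | C a => simp
  | add p q hp hq => simp [hp, hq]
  | mul_X p i hp =>
    fin_cases i <;> simp [hp, MvPolynomial.pderiv_X] <;> ring

/-- The integral of a rational function without poles on an open interval is a primitive there. -/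
theorem hasDerivAt_integral_eval_div (A B : Polynomial ℝ) {I : Set ℝ} (hIopen : IsOpen I)
    (hIconn : I.OrdConnected) (hB : ∀ x ∈ I, B.eval x ≠ 0) {x₀ x : ℝ} (hx₀ : x₀ ∈ I)
    (hx : x ∈ I) :
    HasDerivAt (fun t => ∫ s in x₀..t, A.eval s / B.eval s) (A.eval x / B.eval x) x := by
  have hcont : ContinuousOn (fun s => A.eval s / B.eval s) I :=
    A.continuous.continuousOn.div B.continuous.continuousOn hB
  exact intervalIntegral.integral_hasDerivAt_right
    (hcont.mono (hIconn.uIcc_subset hx₀ hx)).intervalIntegrable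
    (hcont.stronglyMeasurableAtFilter hIopen x hx) (hcont.continuousAt (hIopen.mem_nhds hx))

/-- Proposition 6 of the paper: `V(x,y) = q(x) f(x,y)²`, with
`q(x) = A₂(x) exp(∫_{x₀}^x A₁/A₂)` and `f = g₁ w' − g₀ w`, is an inverse integrating
factor of the system `ẋ = P, ẏ = Q`. -/
theorem stmt_4
    (A₀ A₁ A₂ : Polynomial ℝ) (g₀ g₁ : MvPolynomial (Fin 2) ℝ)
    (I : Set ℝ) (hIopen : IsOpen I) (hIconn : I.OrdConnected)
    (hA₂ : ∀ x ∈ I, A₂.eval x ≠ 0) (x₀ : ℝ) (hx₀ : x₀ ∈ I)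
    (w : ℝ → ℝ)
    (hw₁ : ∀ x ∈ I, DifferentiableAt ℝ w x)
    (hw₂ : ∀ x ∈ I, DifferentiableAt ℝ (deriv w) x)
    (hode : ∀ x ∈ I,
      A₂.eval x * deriv (deriv w) x + A₁.eval x * deriv w x + A₀.eval x * w x = 0)
    (q : ℝ → ℝ)
    (hq : ∀ x, q x = A₂.eval x * Real.exp (∫ s in x₀..x, A₁.eval s / A₂.eval s))
    (f : ℝ → ℝ → ℝ)
    (hf : ∀ x y, f x y = ev2 g₁ x y * deriv w x - ev2 g₀ x y * w x)
    (V : ℝ → ℝ → ℝ)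
    (hV : ∀ x y, V x y = q x * (f x y) ^ 2) :
    ∀ x ∈ I, ∀ y : ℝ,
      Psys A₂ g₀ g₁ x y * deriv (fun t => V t y) x
        + Qsys A₀ A₁ A₂ g₀ g₁ x y * deriv (fun t => V x t) y
      = (deriv (fun t => Psys A₂ g₀ g₁ t y) x
          + deriv (fun t => Qsys A₀ A₁ A₂ g₀ g₁ x t) y) * V x y := by
  intro x hx y
  have hq' : HasDerivAt q
      (A₂.derivative.eval x * Real.exp (∫ s in x₀..x, A₁.eval s / A₂.eval s)
        + A₂.eval x * (Real.exp (∫ s in x₀..x, A₁.eval s / A₂.eval s)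
          * (A₁.eval x / A₂.eval x))) x := by
    rw [funext hq]
    exact (A₂.hasDerivAt x).fun_mul
      (hasDerivAt_integral_eval_div A₁ A₂ hIopen hIconn hA₂ hx₀ hx).exp
  have hVx := hq'.fun_mul ((((hasDerivAt_ev2_fst g₁ x y).fun_mul (hw₂ x hx).hasDerivAt).fun_sub
    ((hasDerivAt_ev2_fst g₀ x y).fun_mul (hw₁ x hx).hasDerivAt)).fun_pow 2)
  have hVy := ((((hasDerivAt_ev2_snd g₁ x y).mul_const (deriv w x)).fun_sub
    ((hasDerivAt_ev2_snd g₀ x y).mul_const (w x))).fun_pow 2).const_mul (q x)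
  have hP := (A₂.hasDerivAt x).fun_mul
    (((hasDerivAt_ev2_fst g₀ x y).fun_mul (hasDerivAt_ev2_fst (pdY g₁) x y)).fun_sub
      ((hasDerivAt_ev2_fst g₁ x y).fun_mul (hasDerivAt_ev2_fst (pdY g₀) x y)))
  have h₀ := hasDerivAt_ev2_snd g₀ x y
  have h₁ := hasDerivAt_ev2_snd g₁ x y
  have hQ := (((((h₁.fun_pow 2).const_mul (A₀.eval x)).fun_add
    ((h₁.const_mul (A₁.eval x)).fun_mul h₀)).fun_add ((h₀.fun_pow 2).const_mul (A₂.eval x))).fun_add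
      (((h₁.fun_mul (hasDerivAt_ev2_snd (pdX g₀) x y)).fun_sub
        (h₀.fun_mul (hasDerivAt_ev2_snd (pdX g₁) x y))).const_mul (A₂.eval x)))
  simp only [hV, hf, Psys, Qsys]
  rw [hVx.deriv, hVy.deriv, hP.deriv, hQ.deriv]
  simp only [pdX_pdY_comm, hq]
  have hdiv : A₂.eval x * (A₁.eval x / A₂.eval x) = A₁.eval x := mul_div_cancel₀ _ (hA₂ x hx)
  generalize Real.exp (∫ s in x₀..x, A₁.eval s / A₂.eval s) = E
  have ode := hode x hx
  push_cast
  linear_combination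
    (A₂.eval x * E * (ev2 g₀ x y * ev2 (pdY g₁) x y - ev2 g₁ x y * ev2 (pdY g₀) x y)
      * (ev2 g₁ x y * deriv w x - ev2 g₀ x y * w x) ^ 2) * hdiv
    + (2 * A₂.eval x * E * (ev2 g₀ x y * ev2 (pdY g₁) x y - ev2 g₁ x y * ev2 (pdY g₀) x y)
      * (ev2 g₁ x y * deriv w x - ev2 g₀ x y * w x) * ev2 g₁ x y) * ode
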